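/- arXiv:2204.08049 — 5 statements merged into one kernel-verified Lean document; each statement's English description precedes it below -/
import Mathlib

section
/- Let L be a skew-symmetric N×N real matrix and s ∈ ℝ^N with L s = 0, and suppose there is an index k₁ with s k₁ ≠ 0. Define ξ i j k := (L i j * δ(k, k₁) + L j k * δ(i, k₁) + L k i * δ(j, k₁)) / s k₁, where δ is the Kronecker delta. Then ξ is totally antisymmetric (ξ i j k = −ξ j i k = −ξ i k j) and it reproduces L upon contraction with s: Σ_k ξ i j k * s k = L i j for all i, j. -/
open Matrix

/-- Given a skew-symmetric `L` with `L s = 0` and an index `k₁` with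
`s k₁ ≠ 0`, the tensor `ξ i j k = (L i j δ_{k k₁} + L j k δ_{i k₁} + L k i δ_{j k₁}) / s k₁`
is totally antisymmetric and reproduces `L` upon contraction with `s`. -/
theorem skew_matrix_tensorial_form
    {N : ℕ} (L : Matrix (Fin N) (Fin N) ℝ) (hL : Lᵀ = -L)
    (s : Fin N → ℝ) (hLs : L *ᵥ s = 0)
    (k₁ : Fin N) (hk₁ : s k₁ ≠ 0)
    (ξ : Fin N → Fin N → Fin N → ℝ)
    (hξ : ∀ i j k, ξ i j k =
      (L i j * (if k = k₁ then (1 : ℝ) else 0)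
        + L j k * (if i = k₁ then (1 : ℝ) else 0)
        + L k i * (if j = k₁ then (1 : ℝ) else 0)) / s k₁) :
    ((∀ i j k, ξ i j k = -ξ j i k) ∧ (∀ i j k, ξ i j k = -ξ i k j))
      ∧ ∀ i j, (∑ k, ξ i j k * s k) = L i j := by
  have skew (i j) : L i j = -L j i := congrFun₂ hL j i
  have kernel (i) : ∑ k, L i k * s k = 0 := congrFun hLs i
  refine ⟨⟨fun i j k => ?_, fun i j k => ?_⟩, fun i j => ?_⟩
  · rw [hξ, hξ, skew j i, skew i k, skew k j]
    ring
  · rw [hξ, hξ, skew i k, skew k j, skew j i]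
    ring
  · have expand (k) : ξ i j k * s k =
        (L i j * (if k = k₁ then s k else 0)
          + (L j k * s k) * (if i = k₁ then 1 else 0)
          - (L i k * s k) * (if j = k₁ then 1 else 0)) / s k₁ := by
      rw [hξ, skew k i]
      split_ifs <;> ring
    simp_rw [expand]
    rw [← Finset.sum_div, Finset.sum_sub_distrib, Finset.sum_add_distrib, ← Finset.mul_sum,
      ← Finset.sum_mul, ← Finset.sum_mul, kernel, kernel]
    simp [hk₁]
end

section
/- Let e ∈ ℝ^N, let k₀ be an index with e k₀ ≠ 0, and let m¹, …, m^r ∈ ℝ^N satisfy m^α · e = 0 for every α. Define the skew matrices A^α by A^α i k := (m^α i * δ(k, k₀) − m^α k * δ(i, k₀)) / e k₀, and define the 4-tensor ζ i k j l := Σ_α A^α i k * A^α j l. Then (a) A^α e = m^α for every α; (b) ζ satisfies the symmetry relations ζ i k j l = −ζ k i j l = −ζ i k l j = ζ j l i k; and (c) ζ reproduces M := Σ_α m^α (m^α)ᵀ upon contraction with e: Σ_{k,l} ζ i k j l * e k * e l = M i j for all i, j. -/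
open Matrix

/-- Given `e` with `e k₀ ≠ 0` and vectors `m^α` orthogonal to `e`, the
skew matrices `A^α i k = (m^α i δ_{k k₀} − m^α k δ_{i k₀}) / e k₀` satisfy `A^α e = m^α`,
the 4-tensor `ζ i k j l = Σ_α A^α i k * A^α j l` has the metriplectic symmetries, and
`ζ` reproduces `M = Σ_α m^α (m^α)ᵀ` upon contraction with `e`. -/
theorem metric_tensorial_form
    {N r : ℕ} (e : Fin N → ℝ) (k₀ : Fin N) (hk₀ : e k₀ ≠ 0)
    (m : Fin r → Fin N → ℝ) (hm : ∀ α, m α ⬝ᵥ e = 0)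
    (A : Fin r → Matrix (Fin N) (Fin N) ℝ)
    (hA : ∀ α i k, A α i k =
      (m α i * (if k = k₀ then (1 : ℝ) else 0)
        - m α k * (if i = k₀ then (1 : ℝ) else 0)) / e k₀)
    (ζ : Fin N → Fin N → Fin N → Fin N → ℝ)
    (hζ : ∀ i k j l, ζ i k j l = ∑ α, A α i k * A α j l) :
    (∀ α, (A α) *ᵥ e = m α)
      ∧ ((∀ i k j l, ζ i k j l = -ζ k i j l)
          ∧ (∀ i k j l, ζ i k j l = -ζ i k l j)
          ∧ (∀ i k j l, ζ i k j l = ζ j l i k))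
      ∧ ∀ i j, (∑ k, ∑ l, ζ i k j l * e k * e l) = (∑ α, vecMulVec (m α) (m α)) i j := by
  have hAe : ∀ α i, ∑ k, A α i k * e k = m α i := by
    intro α i
    have hsum : ∑ k, A α i k * e k
        = (∑ k, m α i * (if k = k₀ then (1 : ℝ) else 0) * e k
          - (if i = k₀ then (1 : ℝ) else 0) * (m α ⬝ᵥ e)) / e k₀ := by
      rw [dotProduct, Finset.mul_sum, ← Finset.sum_sub_distrib, Finset.sum_div]
      refine Finset.sum_congr rfl fun k _ => ?_
      rw [hA]
      ring
    rw [hsum, hm]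
    simp [hk₀]
  have hskew : ∀ α i k, A α i k = -A α k i := by
    intro α i k
    rw [hA, hA]
    ring
  refine ⟨fun α => funext (hAe α), ⟨fun i k j l => ?_, fun i k j l => ?_, fun i k j l => ?_⟩,
    fun i j => ?_⟩
  · rw [hζ, hζ, ← Finset.sum_neg_distrib]
    exact Finset.sum_congr rfl fun α _ => by rw [hskew α i k, neg_mul]
  · rw [hζ, hζ, ← Finset.sum_neg_distrib]
    exact Finset.sum_congr rfl fun α _ => by rw [hskew α j l, mul_neg]
  · rw [hζ, hζ]
    exact Finset.sum_congr rfl fun α _ => mul_comm _ _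
  · calc ∑ k, ∑ l, ζ i k j l * e k * e l
        = ∑ k, ∑ l, ∑ α, A α i k * e k * (A α j l * e l) := by
          refine Finset.sum_congr rfl fun k _ => Finset.sum_congr rfl fun l _ => ?_
          rw [hζ, Finset.sum_mul, Finset.sum_mul]
          exact Finset.sum_congr rfl fun α _ => by ring
      _ = ∑ α, ∑ k, ∑ l, A α i k * e k * (A α j l * e l) := by
          rw [Finset.sum_comm (s := (Finset.univ : Finset (Fin r)))]
          exact Finset.sum_congr rfl fun k _ => Finset.sum_comm
      _ = ∑ α, m α i * m α j := by
          refine Finset.sum_congr rfl fun α _ => ?_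
          rw [← Finset.sum_mul_sum, hAe, hAe]
      _ = (∑ α, vecMulVec (m α) (m α)) i j := by
          simp [Matrix.sum_apply, vecMulVec_apply]
end

section
/- Let U be a real N×n matrix. (a) If ξ : Fin N → Fin N → Fin N → ℝ is totally antisymmetric (ξ i j k = −ξ j i k = −ξ i k j), then the reduced tensor ξ̂ a b c := Σ_{i,j,k} U i a * ξ i j k * U j b * U k c is totally antisymmetric on ℝ^n. (b) If ζ : Fin N → Fin N → Fin N → Fin N → ℝ satisfies ζ i k j l = −ζ k i j l = −ζ i k l j = ζ j l i k, then the reduced tensor ζ̂ a c b d := Σ_{i,k,j,l} U i a * ζ i k j l * U k c * U l d * U j b satisfies the same relations: ζ̂ a c b d = −ζ̂ c a b d = −ζ̂ a c d b = ζ̂ b d a c. -/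
open Matrix

/-- A fourfold sum is unchanged when the first pair of indices is exchanged with the second. -/
theorem Finset.sum_comm_pairs {ι κ M : Type*} [Fintype ι] [Fintype κ] [AddCommMonoid M]
    (f : ι → κ → ι → κ → M) :
    ∑ i, ∑ k, ∑ j, ∑ l, f i k j l = ∑ i, ∑ k, ∑ j, ∑ l, f j l i k := by
  have h := Finset.sum_comm (s := Finset.univ) (t := Finset.univ)
    (f := fun p q : ι × κ => f p.1 p.2 q.1 q.2)
  simpa only [Fintype.sum_prod_type] using h

/-- Reducing a totally antisymmetric 3-tensor `ξ` and a 4-tensor `ζ`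
with the metriplectic symmetries by contracting every slot with a matrix `U` yields
reduced tensors with the same symmetries. -/
theorem reduced_tensors_preserve_symmetries
    {N n : ℕ} (U : Matrix (Fin N) (Fin n) ℝ)
    (ξ : Fin N → Fin N → Fin N → ℝ)
    (hξ1 : ∀ i j k, ξ i j k = -ξ j i k)
    (hξ2 : ∀ i j k, ξ i j k = -ξ i k j)
    (ζ : Fin N → Fin N → Fin N → Fin N → ℝ)
    (hζ1 : ∀ i k j l, ζ i k j l = -ζ k i j l)
    (hζ2 : ∀ i k j l, ζ i k j l = -ζ i k l j)
    (hζ3 : ∀ i k j l, ζ i k j l = ζ j l i k)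
    (ξred : Fin n → Fin n → Fin n → ℝ)
    (hξred : ∀ a b c, ξred a b c = ∑ i, ∑ j, ∑ k, U i a * ξ i j k * U j b * U k c)
    (ζred : Fin n → Fin n → Fin n → Fin n → ℝ)
    (hζred : ∀ a c b d, ζred a c b d =
      ∑ i, ∑ k, ∑ j, ∑ l, U i a * ζ i k j l * U k c * U l d * U j b) :
    ((∀ a b c, ξred a b c = -ξred b a c) ∧ (∀ a b c, ξred a b c = -ξred a c b))
      ∧ ((∀ a c b d, ζred a c b d = -ζred c a b d)
          ∧ (∀ a c b d, ζred a c b d = -ζred a c d b)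
          ∧ (∀ a c b d, ζred a c b d = ζred b d a c)) := by
  refine ⟨⟨fun a b c => ?_, fun a b c => ?_⟩, fun a c b d => ?_, fun a c b d => ?_,
    fun a c b d => ?_⟩
  · rw [hξred, hξred, Finset.sum_comm]
    simp only [← Finset.sum_neg_distrib]
    refine Finset.sum_congr rfl fun i _ => Finset.sum_congr rfl fun j _ =>
      Finset.sum_congr rfl fun k _ => ?_
    rw [hξ1 j i k]
    ring
  · rw [hξred, hξred]
    simp only [← Finset.sum_neg_distrib]
    refine Finset.sum_congr rfl fun i _ => ?_
    rw [Finset.sum_comm]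
    refine Finset.sum_congr rfl fun j _ => Finset.sum_congr rfl fun k _ => ?_
    rw [hξ2 i k j]
    ring
  · rw [hζred, hζred, Finset.sum_comm]
    simp only [← Finset.sum_neg_distrib]
    refine Finset.sum_congr rfl fun i _ => Finset.sum_congr rfl fun k _ =>
      Finset.sum_congr rfl fun j _ => Finset.sum_congr rfl fun l _ => ?_
    rw [hζ1 k i j l]
    ring
  · rw [hζred, hζred]
    simp only [← Finset.sum_neg_distrib]
    refine Finset.sum_congr rfl fun i _ => Finset.sum_congr rfl fun k _ => ?_
    rw [Finset.sum_comm]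
    refine Finset.sum_congr rfl fun j _ => Finset.sum_congr rfl fun l _ => ?_
    rw [hζ2 i k l j]
    ring
  · rw [hζred, hζred, Finset.sum_comm_pairs]
    refine Finset.sum_congr rfl fun i _ => Finset.sum_congr rfl fun k _ =>
      Finset.sum_congr rfl fun j _ => Finset.sum_congr rfl fun l _ => ?_
    rw [hζ3 j l i k]
    ring
end

section
/- Let Ê, Ŝ : ℝ^n → ℝ be differentiable. Let ξ̂ : ℝ^n → (Fin n → Fin n → Fin n → ℝ) assign to each state a totally antisymmetric 3-tensor (ξ̂(y) a b c = −ξ̂(y) b a c = −ξ̂(y) a c b), and let ζ̂ : ℝ^n → (Fin n → Fin n → Fin n → Fin n → ℝ) assign to each state a 4-tensor satisfying ζ̂(y) a c b d = −ζ̂(y) c a b d = −ζ̂(y) a c d b = ζ̂(y) b d a c and such that for every y and w ∈ ℝ^n the matrix with entries Σ_{c,d} ζ̂(y) a c b d * w c * w d is positive semidefinite. Define L̂(y) a b := Σ_c ξ̂(y) a b c * (∇Ŝ(y)) c and M̂(y) a b := Σ_{c,d} ζ̂(y) a c b d * (∇Ê(y)) c * (∇Ê(y)) d. If x̂ : ℝ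 → ℝ^n is differentiable and solves the reduced-order model x̂'(t) = L̂(x̂(t)) ∇Ê(x̂(t)) + M̂(x̂(t)) ∇Ŝ(x̂(t)), then t ↦ Ê(x̂(t)) is constant and t ↦ Ŝ(x̂(t)) is nondecreasing, with (d/dt) Ŝ(x̂(t)) = ⟨∇Ŝ(x̂(t)), M̂(x̂(t)) ∇Ŝ(x̂(t))⟩ ≥ 0. -/
open Matrix RealInnerProductSpace

/-- The quadratic form of a skew-symmetric array vanishes. -/
lemma sum_sum_mul_mul_eq_zero_of_skew {ι : Type*} [Fintype ι] {f : ι → ι → ℝ}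
    (hf : ∀ a b, f a b = -f b a) (u : ι → ℝ) : ∑ a, ∑ b, f a b * u a * u b = 0 := by
  have h : ∑ a, ∑ b, f a b * u a * u b = -∑ a, ∑ b, f a b * u a * u b := by
    conv_lhs => rw [Finset.sum_comm]
    simp only [← Finset.sum_neg_distrib]
    refine Finset.sum_congr rfl fun a _ => Finset.sum_congr rfl fun b _ => ?_
    rw [hf b a]
    ring
  linarith

lemma inner_toEuclideanLin_eq_dotProduct {n : ℕ} (A : Matrix (Fin n) (Fin n) ℝ)
    (u v : EuclideanSpace ℝ (Fin n)) :
    ⟪u, Matrix.toEuclideanLin A v⟫ = u.ofLp ⬝ᵥ A *ᵥ v.ofLp := by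
  simp [EuclideanSpace.inner_eq_star_dotProduct, dotProduct_comm]

lemma inner_toEuclideanLin_eq_sum {n : ℕ} (A : Matrix (Fin n) (Fin n) ℝ)
    (u v : EuclideanSpace ℝ (Fin n)) :
    ⟪u, Matrix.toEuclideanLin A v⟫ = ∑ b, (∑ a, u a * A a b) * v b := by
  rw [inner_toEuclideanLin_eq_dotProduct, dotProduct_mulVec]
  rfl

/-- Chain rule along a curve, expressed through the gradient. -/
lemma HasDerivAt.comp_inner_gradient {F : Type*} [NormedAddCommGroup F] [InnerProductSpace ℝ F]
    [CompleteSpace F] {f : F → ℝ} {x : ℝ → F} {v : F} {t : ℝ}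
    (hf : DifferentiableAt ℝ f (x t)) (hx : HasDerivAt x v t) :
    HasDerivAt (fun τ => f (x τ)) ⟪gradient f (x t), v⟫ t := by
  exact hf.hasGradientAt.hasFDerivAt.comp_hasDerivAt t hx

/-- The structure-preserving reduced-order model built from a
state-dependent totally antisymmetric 3-tensor `ξ̂` and a 4-tensor `ζ̂` with the
metriplectic symmetries and positive semidefinite contractions conserves the reduced
energy `Ê` and produces the reduced entropy `Ŝ`. -/
theorem reduced_order_model_energy_entropy
    {n : ℕ}
    (Ehat Shat : EuclideanSpace ℝ (Fin n) → ℝ)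
    (hE : Differentiable ℝ Ehat) (hS : Differentiable ℝ Shat)
    (ξhat : EuclideanSpace ℝ (Fin n) → (Fin n → Fin n → Fin n → ℝ))
    (hξ1 : ∀ y a b c, ξhat y a b c = -ξhat y b a c)
    (hξ2 : ∀ y a b c, ξhat y a b c = -ξhat y a c b)
    (ζhat : EuclideanSpace ℝ (Fin n) → (Fin n → Fin n → Fin n → Fin n → ℝ))
    (hζ1 : ∀ y a c b d, ζhat y a c b d = -ζhat y c a b d)
    (hζ2 : ∀ y a c b d, ζhat y a c b d = -ζhat y a c d b)
    (hζ3 : ∀ y a c b d, ζhat y a c b d = ζhat y b d a c)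
    (hζpsd : ∀ y (w : Fin n → ℝ),
      (Matrix.of fun a b => ∑ c, ∑ d, ζhat y a c b d * w c * w d).PosSemidef)
    (Lhat Mhat : EuclideanSpace ℝ (Fin n) → Matrix (Fin n) (Fin n) ℝ)
    (hLhat : ∀ y, Lhat y =
      Matrix.of fun a b => ∑ c, ξhat y a b c * gradient Shat y c)
    (hMhat : ∀ y, Mhat y =
      Matrix.of fun a b => ∑ c, ∑ d, ζhat y a c b d * gradient Ehat y c * gradient Ehat y d)
    (xhat : ℝ → EuclideanSpace ℝ (Fin n))
    (hxhat : ∀ t : ℝ, HasDerivAt xhat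
      (Matrix.toEuclideanLin (Lhat (xhat t)) (gradient Ehat (xhat t))
        + Matrix.toEuclideanLin (Mhat (xhat t)) (gradient Shat (xhat t))) t) :
    (∀ t₁ t₂ : ℝ, Ehat (xhat t₁) = Ehat (xhat t₂))
      ∧ Monotone (fun t => Shat (xhat t))
      ∧ ∀ t : ℝ, HasDerivAt (fun τ => Shat (xhat τ))
            ⟪gradient Shat (xhat t),
              Matrix.toEuclideanLin (Mhat (xhat t)) (gradient Shat (xhat t))⟫ t
          ∧ 0 ≤ ⟪gradient Shat (xhat t),
              Matrix.toEuclideanLin (Mhat (xhat t)) (gradient Shat (xhat t))⟫ := by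
  have hLEE : ∀ y, ⟪gradient Ehat y, Matrix.toEuclideanLin (Lhat y) (gradient Ehat y)⟫ = 0 := by
    intro y
    have hskew : ∀ b a, Lhat y a b = -Lhat y b a := fun b a => by
      simp only [hLhat, Matrix.of_apply, ← Finset.sum_neg_distrib]
      refine Finset.sum_congr rfl fun c _ => ?_
      rw [hξ1 y a b c]
      ring
    rw [inner_toEuclideanLin_eq_sum,
      ← sum_sum_mul_mul_eq_zero_of_skew (fun b a => hskew a b) (gradient Ehat y).ofLp,
      Finset.sum_comm]
    refine Finset.sum_congr rfl fun b _ => ?_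
    rw [Finset.sum_mul]
    exact Finset.sum_congr rfl fun a _ => by ring
  have hLSE : ∀ y, ⟪gradient Shat y, Matrix.toEuclideanLin (Lhat y) (gradient Ehat y)⟫ = 0 := by
    intro y
    rw [inner_toEuclideanLin_eq_sum]
    refine Finset.sum_eq_zero fun b _ => mul_eq_zero_of_left ?_ _
    have hskew : ∀ a c, ξhat y a b c = -ξhat y c b a := fun a c => by
      rw [hξ1 y a b c, hξ2 y b a c, hξ1 y b c a, neg_neg]
    rw [← sum_sum_mul_mul_eq_zero_of_skew hskew (gradient Shat y).ofLp]
    refine Finset.sum_congr rfl fun a _ => ?_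
    rw [hLhat, Matrix.of_apply, Finset.mul_sum]
    exact Finset.sum_congr rfl fun c _ => by ring
  have hMES : ∀ y, ⟪gradient Ehat y, Matrix.toEuclideanLin (Mhat y) (gradient Shat y)⟫ = 0 := by
    intro y
    rw [inner_toEuclideanLin_eq_sum]
    refine Finset.sum_eq_zero fun b _ => mul_eq_zero_of_left ?_ _
    have hskew : ∀ a c, ∑ d, ζhat y a c b d * gradient Ehat y d
        = -∑ d, ζhat y c a b d * gradient Ehat y d := fun a c => by
      rw [← Finset.sum_neg_distrib]
      refine Finset.sum_congr rfl fun d _ => ?_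
      rw [hζ1 y a c b d]
      ring
    rw [← sum_sum_mul_mul_eq_zero_of_skew hskew (gradient Ehat y).ofLp]
    refine Finset.sum_congr rfl fun a _ => ?_
    rw [hMhat, Matrix.of_apply, Finset.mul_sum]
    refine Finset.sum_congr rfl fun c _ => ?_
    simp only [Finset.mul_sum, Finset.sum_mul]
    exact Finset.sum_congr rfl fun d _ => by ring
  have hMSS : ∀ y, 0 ≤ ⟪gradient Shat y, Matrix.toEuclideanLin (Mhat y) (gradient Shat y)⟫ := by
    intro y
    rw [inner_toEuclideanLin_eq_dotProduct, hMhat]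
    simpa using (hζpsd y (gradient Ehat y).ofLp).dotProduct_mulVec_nonneg (gradient Shat y).ofLp
  have hdE : ∀ t, HasDerivAt (fun τ => Ehat (xhat τ)) 0 t := fun t => by
    simpa only [inner_add_right, hLEE, hMES, add_zero] using
      HasDerivAt.comp_inner_gradient (hE (xhat t)) (hxhat t)
  have hdS : ∀ t, HasDerivAt (fun τ => Shat (xhat τ))
      ⟪gradient Shat (xhat t), Matrix.toEuclideanLin (Mhat (xhat t)) (gradient Shat (xhat t))⟫ t :=
    fun t => by
      simpa only [inner_add_right, hLSE, zero_add] using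
        HasDerivAt.comp_inner_gradient (hS (xhat t)) (hxhat t)
  exact ⟨is_const_of_deriv_eq_zero (fun t => (hdE t).differentiableAt) fun t => (hdE t).deriv,
    monotone_of_hasDerivAt_nonneg hdS fun t => hMSS (xhat t),
    fun t => ⟨hdS t, hMSS (xhat t)⟩⟩
end

section
/- For the semi-discretized thermoelastic rod with state x = (q, p, S) ∈ ℝ^N × ℝ^N × ℝ, mass m > 0 and γ ≥ 0, the metric matrix M(x) = γ · [[0, 0, 0], [0, I, −p/m], [0, −pᵀ/m, |p|²/m²]] decomposes as M(x) = Σ_{α=1}^{N} m^α(x) (m^α(x))ᵀ, where m^α(x) := √γ · (0, e_α, −p_α/m) ∈ ℝ^{2N+1} and e_α is the α-th standard basis vector of ℝ^N; moreover each m^α(x) is orthogonal to the energy gradient ∇E(x) = (V'(q), p/m, 1): m^α(x) · ∇E(x) = 0 for every α. -/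
open Matrix

/-- The metric matrix `M = γ [[0,0,0],[0,I,−p/m],[0,−pᵀ/m,|p|²/m²]]` of the
semi-discretized thermoelastic rod, on the index set `Fin N ⊕ Fin N ⊕ Unit`. -/
noncomputable def rodM (N : ℕ) (γ m : ℝ) (p : Fin N → ℝ) :
    Matrix (Fin N ⊕ Fin N ⊕ Unit) (Fin N ⊕ Fin N ⊕ Unit) ℝ :=
  Matrix.of fun i j =>
    match i, j with
    | Sum.inr (Sum.inl a), Sum.inr (Sum.inl b) => if a = b then γ else 0
    | Sum.inr (Sum.inl a), Sum.inr (Sum.inr _) => γ * (-(p a) / m)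
    | Sum.inr (Sum.inr _), Sum.inr (Sum.inl b) => γ * (-(p b) / m)
    | Sum.inr (Sum.inr _), Sum.inr (Sum.inr _) => γ * ((∑ i, (p i) ^ 2) / m ^ 2)
    | _, _ => 0

/-- The factor `m^α = √γ (0, e_α, −p_α/m)` of the rod metric matrix. -/
noncomputable def rodm (N : ℕ) (γ m : ℝ) (p : Fin N → ℝ) (α : Fin N) :
    Fin N ⊕ Fin N ⊕ Unit → ℝ :=
  fun i => match i with
  | Sum.inl _ => 0
  | Sum.inr (Sum.inl b) => Real.sqrt γ * (if b = α then 1 else 0)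
  | Sum.inr (Sum.inr _) => Real.sqrt γ * (-(p α) / m)

/-- The energy gradient `∇E = (V'(q), p/m, 1)` of the thermoelastic rod with energy
`E(q,p,S) = Σ_i (p_i²/(2m) + V(q_i)) + S`. -/
noncomputable def rodGradE (N : ℕ) (m : ℝ) (V : ℝ → ℝ) (q p : Fin N → ℝ) :
    Fin N ⊕ Fin N ⊕ Unit → ℝ :=
  fun i => match i with
  | Sum.inl a => deriv V (q a)
  | Sum.inr (Sum.inl a) => p a / m
  | Sum.inr (Sum.inr _) => 1

/-- For the semi-discretized thermoelastic rod with mass `m > 0` and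
`γ ≥ 0`, the metric matrix decomposes as `M = Σ_α m^α (m^α)ᵀ` with
`m^α = √γ (0, e_α, −p_α/m)`, and each `m^α` is orthogonal to the energy gradient
`∇E = (V'(q), p/m, 1)`. -/
theorem thermoelastic_rod_metric_decomposition
    (N : ℕ) (m γ : ℝ) (hm : 0 < m) (hγ : 0 ≤ γ)
    (V : ℝ → ℝ) (hV : Differentiable ℝ V)
    (q p : Fin N → ℝ) :
    rodM N γ m p = ∑ α, vecMulVec (rodm N γ m p α) (rodm N γ m p α)
      ∧ ∀ α, rodm N γ m p α ⬝ᵥ rodGradE N m V q p = 0 := by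
  have hs (x y : ℝ) : √γ * x * (√γ * y) = γ * (x * y) := by
    rw [mul_mul_mul_comm, Real.mul_self_sqrt hγ]
  constructor
  · ext i j
    rw [Matrix.sum_apply]
    rcases i with _ | a | _ <;> rcases j with _ | b | _ <;>
      simp only [rodM, rodm, of_apply, vecMulVec_apply, zero_mul, mul_zero,
        Finset.sum_const_zero, hs, ← Finset.mul_sum]
    · simp
    · simp
    · simp
    · simp only [Finset.sum_div]
      congr 1
      refine Finset.sum_congr rfl fun i _ => ?_
      ring
  · intro α
    simp only [dotProduct, rodm, rodGradE, Fintype.sum_sum_type, zero_mul, mul_one, mul_ite, mul_zero, ite_mul,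
      Finset.sum_const_zero, Finset.sum_ite_eq', Finset.mem_univ, if_true, Finset.univ_unique, Finset.sum_singleton]
    ring
end
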